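/- arXiv:1510.06839 — 2 statements merged into one kernel-verified Lean document; each statement's English description precedes it below -/
import Mathlib

section
/- If a finite simple graph G contains no induced subgraph isomorphic to the complement of an odd cycle C_{2n+1} for any n ≥ 1, then the vertex set of G can be written as the union of two cliques of G. -/
open SimpleGraph

namespace SimpleGraph

variable {V : Type*} {H : SimpleGraph V}

/-- The stretch of a walk between two of its positions. -/
lemma Walk.exists_walk_getVert {u v : V} (w : H.Walk u v) {i j : ℕ} (hij : i ≤ j)
    (hj : j ≤ w.length) : ∃ p : H.Walk (w.getVert i) (w.getVert j), p.length = j - i := by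
  have e : (w.drop i).getVert (j - i) = w.getVert j := by
    rw [Walk.drop_getVert]; congr 1; omega
  refine ⟨((w.drop i).take (j - i)).copy rfl e, ?_⟩
  simp only [Walk.length_copy, Walk.take_length, Walk.drop_length]
  omega

/-- In a shortest odd closed walk, a walk `q` joining two positions `i ≤ j` cannot be used to
shorten the closed walk. -/
lemma Walk.le_of_isShortest_odd {u : V} {w : H.Walk u u} (hodd : Odd w.length)
    (hmin : ∀ (x : V) (p : H.Walk x x), Odd p.length → w.length ≤ p.length)
    {i j : ℕ} (hij : i ≤ j) (hj : j ≤ w.length) (q : H.Walk (w.getVert i) (w.getVert j)) :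
    (Odd (j - i + q.length) ∧ w.length ≤ j - i + q.length) ∨
      (Even (j - i + q.length) ∧ j - i ≤ q.length) := by
  obtain ⟨p, hp⟩ := w.exists_walk_getVert hij hj
  rcases Nat.even_or_odd (j - i + q.length) with he | ho
  · right
    have h := hmin u (((w.take i).append q).append (w.drop j))
    simp only [Walk.length_append, Walk.take_length, Walk.drop_length] at h
    refine ⟨he, ?_⟩
    have := h (by grind)
    omega
  · left
    refine ⟨ho, ?_⟩
    have h := hmin _ (p.append q.reverse)
    rw [Walk.length_append, Walk.length_reverse, hp] at h
    exact h ho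

/-- A shortest odd closed walk traverses an induced cycle. -/
lemma Walk.nonempty_cycleGraph_embedding_of_isShortest_odd {u : V} {w : H.Walk u u}
    (hodd : Odd w.length)
    (hmin : ∀ (x : V) (p : H.Walk x x), Odd p.length → w.length ≤ p.length) :
    Nonempty (cycleGraph w.length ↪g H) := by
  have inj : ∀ i j : ℕ, i < j → j < w.length → w.getVert i ≠ w.getVert j := by
    intro i j hij hj h
    have := le_of_isShortest_odd hodd hmin hij.le hj.le (Walk.nil.copy rfl h)
    simp only [Walk.length_copy, Walk.length_nil] at this
    omega
  have adj : ∀ i j : ℕ, i < j → j < w.length →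
      (H.Adj (w.getVert i) (w.getVert j) ↔ j - i = 1 ∨ w.length - (j - i) = 1) := by
    intro i j hij hj
    constructor
    · intro h
      have := le_of_isShortest_odd hodd hmin hij.le hj.le h.toWalk
      simp only [Walk.length_cons, Walk.length_nil] at this
      omega
    · rintro (h | h)
      · obtain rfl : j = i + 1 := by omega
        exact w.adj_getVert_succ (by omega)
      · obtain rfl : i = 0 := by omega
        have hl : j + 1 = w.length := by omega
        have := w.adj_getVert_succ hj
        rw [hl, Walk.getVert_length] at this
        simpa using this.symm
  have key : ∀ a b : Fin w.length, a < b →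
      (H.Adj (w.getVert a) (w.getVert b) ↔ (cycleGraph w.length).Adj a b) := by
    intro a b hab
    rw [adj a b hab b.2, cycleGraph_adj', Fin.sub_val_of_le hab.le, Fin.coe_sub_iff_lt.mpr hab]
    have : (a : ℕ) < b := hab
    omega
  refine ⟨⟨⟨fun a => w.getVert a, ?_⟩, ?_⟩⟩
  · intro a b h
    rcases lt_trichotomy a b with hab | hab | hab
    · exact (inj a b hab b.2 h).elim
    · exact hab
    · exact (inj b a hab a.2 h.symm).elim
  · intro a b
    rcases lt_trichotomy a b with hab | rfl | hab
    · exact key a b hab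
    · simp
    · rw [H.adj_comm, (cycleGraph _).adj_comm]
      exact key b a hab

/-- A graph without induced odd cycles is bipartite. -/
theorem colorable_two_of_isEmpty_cycleGraph_embedding
    (h : ∀ n : ℕ, 1 ≤ n → IsEmpty (cycleGraph (2 * n + 1) ↪g H)) : H.Colorable 2 := by
  classical
  rw [two_colorable_iff_forall_loop_even]
  by_contra! hne
  have hex : ∃ m, ∃ (u : V) (w : H.Walk u u), Odd w.length ∧ w.length = m := by
    obtain ⟨u, w, hw⟩ := hne
    exact ⟨_, u, w, Nat.not_even_iff_odd.mp hw, rfl⟩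
  obtain ⟨u, w, hodd, hlen⟩ := Nat.find_spec hex
  obtain ⟨f⟩ := Walk.nonempty_cycleGraph_embedding_of_isShortest_odd hodd
    fun x p hp => hlen ▸ Nat.find_min' hex ⟨x, p, hp, rfl⟩
  obtain ⟨n, hn⟩ := hodd
  have hn1 : 1 ≤ n := by
    by_contra hn0
    have := Walk.adj_of_length_eq_one (p := w) (by omega)
    exact H.loopless.irrefl _ this
  rw [hn] at f
  exact (h n hn1).false f

end SimpleGraph

theorem union_of_two_cliques_of_no_induced_odd_cycle_complement
    {V : Type*} [Fintype V] (G : SimpleGraph V)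
    (h : ∀ n : ℕ, 1 ≤ n → IsEmpty ((cycleGraph (2 * n + 1))ᶜ ↪g G)) :
    ∃ R₁ R₂ : Set V, G.IsClique R₁ ∧ G.IsClique R₂ ∧ R₁ ∪ R₂ = Set.univ := by
  have hcol : Gᶜ.Colorable 2 := colorable_two_of_isEmpty_cycleGraph_embedding fun n hn =>
    ⟨fun f => (h n hn).false (Embedding.complEquiv.symm (by rwa [compl_compl]))⟩
  obtain ⟨c⟩ := hcol
  have hclique (k : Fin 2) : G.IsClique (c.colorClass k) :=
    (isIndepSet_compl G).mp (c.isIndepSet_colorClass k)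
  refine ⟨c.colorClass 0, c.colorClass 1, hclique 0, hclique 1, ?_⟩
  ext v
  have : c v = 0 ∨ c v = 1 := by omega
  simpa [Coloring.colorClass] using this
end

section
/- Let G be a finite simple graph that contains neither 3K₁ (three pairwise non-adjacent vertices) nor C₅ (the 5-cycle) as an induced subgraph, and suppose G is not complete. Let v, w be non-adjacent vertices of G, and define B = {b ∈ V(G) : bv ∈ E(G), bw ∉ E(G)}, C = {c ∈ V(G) : cw ∈ E(G), cv ∉ E(G)}, A₁ = {a ∈ V(G) : av, aw ∈ E(G) and ac ∉ E(G) for some c ∈ C}, and A₂ = {a ∈ V(G) : av, aw ∈ E(G) and ab ∉ E(G) for some b ∈ B}. Then each of the sets B, C, A₁ and A₂ is a clique of G. -/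
open SimpleGraph

namespace SimpleGraph

variable {V : Type*} {G : SimpleGraph V}

/-- In a `3K₁`-free graph, two distinct vertices with a common non-neighbour are adjacent. -/
theorem adj_of_isEmpty_bot_embedding (h : IsEmpty ((⊥ : SimpleGraph (Fin 3)) ↪g G)) {x y z : V}
    (hxy : x ≠ y) (hxz : x ≠ z) (hyz : y ≠ z) (nxz : ¬ G.Adj x z) (nyz : ¬ G.Adj y z) :
    G.Adj x y := by
  by_contra nxy
  refine h.false ⟨⟨![x, y, z], fun i j hij ↦ ?_⟩, fun {i j} ↦ ?_⟩
  · fin_cases i <;> fin_cases j <;> simp_all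
  · change G.Adj (![x, y, z] i) (![x, y, z] j) ↔ _
    fin_cases i <;> fin_cases j <;>
      simp [nxy, nxz, nyz, mt G.adj_symm nxy, mt G.adj_symm nxz, mt G.adj_symm nyz]

/-- Five vertices inducing a 5-cycle give an embedding of `cycleGraph 5`. -/
theorem nonempty_cycleGraph_five_embedding {p q r s t : V}
    (pq : G.Adj p q) (qr : G.Adj q r) (rs : G.Adj r s) (st : G.Adj s t) (tp : G.Adj t p)
    (pr : ¬ G.Adj p r) (qs : ¬ G.Adj q s) (rt : ¬ G.Adj r t) (sp : ¬ G.Adj s p)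
    (tq : ¬ G.Adj t q) : Nonempty (cycleGraph 5 ↪g G) := by
  have key : ∀ i j, G.Adj (![p, q, r, s, t] i) (![p, q, r, s, t] j) ↔
      (cycleGraph 5).Adj i j := by
    intro i j
    rw [cycleGraph_adj]
    fin_cases i <;> fin_cases j <;> simp [pq, qr, rs, st, tp, pr, qs, rt, sp, tq,
      pq.symm, qr.symm, rs.symm, st.symm, tp.symm, mt G.adj_symm pr, mt G.adj_symm qs, mt G.adj_symm rt,
      mt G.adj_symm sp, mt G.adj_symm tq] <;> decide
  refine ⟨⟨⟨![p, q, r, s, t], fun i j hij ↦ ?_⟩, fun {i j} ↦ key i j⟩⟩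
  have same : ∀ k, (cycleGraph 5).Adj i k ↔ (cycleGraph 5).Adj j k := fun k ↦ by
    rw [← key, ← key, hij]
  simp only [cycleGraph_adj] at same
  clear hij
  revert i j
  decide

theorem isClique_adj_not_adj (h : IsEmpty ((⊥ : SimpleGraph (Fin 3)) ↪g G)) {v w : V}
    (hadj : ¬ G.Adj v w) : G.IsClique {b : V | G.Adj b v ∧ ¬ G.Adj b w} := by
  rintro x ⟨xv, xw⟩ y ⟨yv, yw⟩ hxy
  refine adj_of_isEmpty_bot_embedding h hxy ?_ ?_ xw yw
  · rintro rfl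
    exact hadj xv.symm
  · rintro rfl
    exact hadj yv.symm

theorem isClique_common_neighbors_not_complete (h3K1 : IsEmpty ((⊥ : SimpleGraph (Fin 3)) ↪g G))
    (hC5 : IsEmpty (cycleGraph 5 ↪g G)) {v w : V} (hadj : ¬ G.Adj v w) :
    G.IsClique {a : V | G.Adj a v ∧ G.Adj a w ∧
      ∃ c, (G.Adj c w ∧ ¬ G.Adj c v) ∧ ¬ G.Adj a c} := by
  rintro x ⟨xv, -, c, ⟨cw, cv⟩, xc⟩ y ⟨yv, -, d, ⟨dw, dv⟩, yd⟩ hxy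
  by_contra nxy
  have ne_of_adj : ∀ {a e : V}, G.Adj a v → ¬ G.Adj e v → a ≠ e := by
    rintro a _ ha he rfl
    exact he ha
  have yc : G.Adj y c := by
    by_contra yc
    exact nxy (adj_of_isEmpty_bot_embedding h3K1 hxy (ne_of_adj xv cv) (ne_of_adj yv cv) xc yc)
  have xd : G.Adj x d := by
    by_contra xd
    exact nxy (adj_of_isEmpty_bot_embedding h3K1 hxy (ne_of_adj xv dv) (ne_of_adj yv dv) xd yd)
  have hdc : d ≠ c := by
    rintro rfl
    exact yd yc
  have dc : G.Adj d c :=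
    isClique_adj_not_adj h3K1 (mt G.adj_symm hadj) ⟨dw, dv⟩ ⟨cw, cv⟩ hdc
  exact not_isEmpty_iff.mpr (nonempty_cycleGraph_five_embedding xv.symm xd dc yc.symm yv
    (mt G.adj_symm dv) xc (mt G.adj_symm yd) cv (mt G.adj_symm nxy)) hC5

end SimpleGraph

theorem cliques_of_3K1_and_C5_free
    {V : Type*} [Fintype V] (G : SimpleGraph V)
    (h3K1 : IsEmpty ((⊥ : SimpleGraph (Fin 3)) ↪g G))
    (hC5 : IsEmpty (cycleGraph 5 ↪g G))
    (hnc : G ≠ ⊤)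
    (v w : V) (hvw : v ≠ w) (hadj : ¬ G.Adj v w) :
    G.IsClique {b : V | G.Adj b v ∧ ¬ G.Adj b w} ∧
    G.IsClique {c : V | G.Adj c w ∧ ¬ G.Adj c v} ∧
    G.IsClique {a : V | G.Adj a v ∧ G.Adj a w ∧
      ∃ c, (G.Adj c w ∧ ¬ G.Adj c v) ∧ ¬ G.Adj a c} ∧
    G.IsClique {a : V | G.Adj a v ∧ G.Adj a w ∧
      ∃ b, (G.Adj b v ∧ ¬ G.Adj b w) ∧ ¬ G.Adj a b} := by
  have hadj' : ¬ G.Adj w v := mt G.adj_symm hadj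
  refine ⟨isClique_adj_not_adj h3K1 hadj, isClique_adj_not_adj h3K1 hadj',
    isClique_common_neighbors_not_complete h3K1 hC5 hadj,
    (isClique_common_neighbors_not_complete h3K1 hC5 hadj').subset ?_⟩
  rintro a ⟨av, aw, h⟩
  exact ⟨aw, av, h⟩
end
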